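/- Let (M,d) be a cone metric space over a real Banach space E with cone P having nonempty interior, and let τ_c be the cone topology on M, i.e., the topology generated by the sub-basis of balls B(b,c) = {y ∈ M : d(y,b) ≪ c} for b ∈ M and 0 ≪ c. Then a map T : M → M is continuous with respect to τ_c if and only if T is sequentially continuous, i.e., whenever a sequence (xₙ) converges to x in the cone-metric sense, (Txₙ) converges to Tx. -/

import Mathlib

/-- `P` is a cone in the real Banach space `E`. -/
def IsCone {E : Type*} [NormedAddCommGroup E] [NormedSpace ℝ E] (P : Set E) : Prop :=
  IsClosed P ∧ P.Nonempty ∧ P ≠ {0} ∧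
    (∀ a b : ℝ, 0 ≤ a → 0 ≤ b → ∀ x ∈ P, ∀ y ∈ P, a • x + b • y ∈ P) ∧
    P ∩ (-P) = {0}

/-- The partial order induced by the cone `P`: `x ≤ y` iff `y - x ∈ P`. -/
def ConeLe {E : Type*} [NormedAddCommGroup E] [NormedSpace ℝ E] (P : Set E) (x y : E) : Prop :=
  y - x ∈ P

/-- `x ≪ y` iff `y - x ∈ interior P`. -/
def ConeLt {E : Type*} [NormedAddCommGroup E] [NormedSpace ℝ E] (P : Set E) (x y : E) : Prop :=
  y - x ∈ interior P

/-- `P` is a normal cone with normal constant `K`. -/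
def IsNormalCone {E : Type*} [NormedAddCommGroup E] [NormedSpace ℝ E] (P : Set E) (K : ℝ) : Prop :=
  0 < K ∧ ∀ x y : E, ConeLe P 0 x → ConeLe P x y → ‖x‖ ≤ K * ‖y‖

/-- `d` is a cone metric on `M` with respect to the cone `P`. -/
def IsConeMetric {E M : Type*} [NormedAddCommGroup E] [NormedSpace ℝ E]
    (P : Set E) (d : M → M → E) : Prop :=
  (∀ x y : M, ConeLe P 0 (d x y)) ∧
  (∀ x y : M, d x y = 0 ↔ x = y) ∧
  (∀ x y : M, d x y = d y x) ∧
  (∀ x y z : M, ConeLe P (d x y) (d x z + d z y))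

/-- Convergence of a sequence in a cone metric space. -/
def ConeConv {E M : Type*} [NormedAddCommGroup E] [NormedSpace ℝ E]
    (P : Set E) (d : M → M → E) (u : ℕ → M) (x : M) : Prop :=
  ∀ c : E, ConeLt P 0 c → ∃ n₀ : ℕ, ∀ n ≥ n₀, ConeLt P (d (u n) x) c

/-- Cauchy sequences in a cone metric space. -/
def ConeCauchy {E M : Type*} [NormedAddCommGroup E] [NormedSpace ℝ E]
    (P : Set E) (d : M → M → E) (u : ℕ → M) : Prop :=
  ∀ c : E, ConeLt P 0 c → ∃ n₀ : ℕ, ∀ n ≥ n₀, ∀ m ≥ n₀, ConeLt P (d (u n) (u m)) c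

/-- Completeness of a cone metric space. -/
def ConeComplete {E M : Type*} [NormedAddCommGroup E] [NormedSpace ℝ E]
    (P : Set E) (d : M → M → E) : Prop :=
  ∀ u : ℕ → M, ConeCauchy P d u → ∃ x : M, ConeConv P d u x

/-- Sequential continuity of a self-map of a cone metric space. -/
def ConeSeqContinuous {E M : Type*} [NormedAddCommGroup E] [NormedSpace ℝ E]
    (P : Set E) (d : M → M → E) (T : M → M) : Prop :=
  ∀ (u : ℕ → M) (x : M), ConeConv P d u x → ConeConv P d (fun n => T (u n)) (T x)

/-- `(S, T)` is a pair of generalized Zamfirescu operators with constants `a`, `b`, `c`. -/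
def IsGZO {E M : Type*} [NormedAddCommGroup E] [NormedSpace ℝ E]
    (P : Set E) (d : M → M → E) (S T : M → M) (a b c : ℝ) : Prop :=
  0 ≤ a ∧ a < 1 ∧ 0 ≤ b ∧ b < 1/2 ∧ 0 ≤ c ∧ c < 1/2 ∧
    ∀ x y : M,
      ConeLe P (d (S x) (S y)) (a • d (T x) (T y)) ∨
      ConeLe P (d (S x) (S y)) (b • (d (S x) (T x) + d (S y) (T y))) ∨
      ConeLe P (d (S x) (S y)) (c • (d (S x) (T y) + d (S y) (T x)))

/-- `(S, T)` is a generalized weak contraction. -/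
def IsGWC {E M : Type*} [NormedAddCommGroup E] [NormedSpace ℝ E]
    (P : Set E) (d : M → M → E) (S T : M → M) : Prop :=
  ∃ δ L : ℝ, 0 < δ ∧ δ < 1 ∧ 0 ≤ L ∧
    ∀ x y : M, ConeLe P (d (S x) (S y)) (δ • d (T x) (T y) + L • d (S x) (T x))

/-- The cone topology on a cone metric space, generated by the sub-basis of balls
B(b,c) = {y : d(y,b) ≪ c} for b ∈ M and 0 ≪ c. -/
def coneTopology {E M : Type*} [NormedAddCommGroup E] [NormedSpace ℝ E]
    (P : Set E) (d : M → M → E) : TopologicalSpace M :=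
  TopologicalSpace.generateFrom
    {B | ∃ (b : M) (c : E), ConeLt P 0 c ∧ B = {y : M | ConeLt P (d y b) c}}

section ConeMetric

open Filter Topology

variable {E M : Type*} [NormedAddCommGroup E] [NormedSpace ℝ E] {P : Set E} {d : M → M → E}

theorem IsCone.add_mem (hP : IsCone P) {x y : E} (hx : x ∈ P) (hy : y ∈ P) : x + y ∈ P := by
  simpa using hP.2.2.2.1 1 1 zero_le_one zero_le_one x hx y hy

theorem IsCone.smul_mem (hP : IsCone P) {t : ℝ} (ht : 0 ≤ t) {x : E} (hx : x ∈ P) :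
    t • x ∈ P := by
  simpa using hP.2.2.2.1 t 0 ht le_rfl x hx x hx

theorem IsCone.interior_add_mem (hP : IsCone P) {x y : E} (hx : x ∈ interior P) (hy : y ∈ P) :
    x + y ∈ interior P := by
  have hsub : (fun z => z + y) '' interior P ⊆ interior P := by
    refine interior_maximal ?_ (isOpenMap_add_right y _ isOpen_interior)
    rintro _ ⟨z, hz, rfl⟩
    exact hP.add_mem (interior_subset hz) hy
  exact hsub ⟨x, hx, rfl⟩

theorem IsCone.smul_mem_interior (hP : IsCone P) {t : ℝ} (ht : 0 < t) {x : E}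
    (hx : x ∈ interior P) : t • x ∈ interior P := by
  have hsub : (fun z => t • z) '' interior P ⊆ interior P := by
    refine interior_maximal ?_ (isOpenMap_smul₀ ht.ne' _ isOpen_interior)
    rintro _ ⟨z, hz, rfl⟩
    exact hP.smul_mem ht.le (interior_subset hz)
  exact hsub ⟨x, hx, rfl⟩

/-- Every `c ≫ 0` dominates a small multiple of any given vector. -/
theorem exists_nat_smul_coneLt {c : E} (hc : c ∈ interior P) (e : E) :
    ∃ n : ℕ, ConeLt P ((1 / ((n : ℝ) + 1)) • e) c := by
  have hlim : Tendsto (fun n : ℕ => c - (1 / ((n : ℝ) + 1)) • e) atTop (𝓝 c) := by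
    simpa using (tendsto_one_div_add_atTop_nhds_zero_nat (𝕜 := ℝ)).smul_const e |>.const_sub c
  exact (hlim.eventually (isOpen_interior.mem_nhds hc)).exists

theorem coneBall_mem_nhds (hd : IsConeMetric P d) (x : M) {c : E} (hc : ConeLt P 0 c) :
    {y | ConeLt P (d y x) c} ∈ @nhds M (coneTopology P d) x := by
  let _ : TopologicalSpace M := coneTopology P d
  refine IsOpen.mem_nhds (TopologicalSpace.isOpen_generateFrom_of_mem ⟨x, c, hc, rfl⟩) ?_
  simpa [(hd.2.1 x x).2 rfl] using hc

/-- A ball containing `x` contains a ball centred at `x`. -/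
theorem coneBall_subset (hP : IsCone P) (hd : IsConeMetric P d) {x b : M} {c r : E}
    (hr : ConeLt P r (c - d x b)) :
    {y | ConeLt P (d y x) r} ⊆ {y | ConeLt P (d y b) c} := by
  intro y hy
  have h := hP.interior_add_mem
    (hP.interior_add_mem hr (interior_subset hy)) (hd.2.2.2 y b x)
  have heq : c - d x b - r + (r - d y x) + (d y x + d x b - d y b) = c - d y b := by abel
  rwa [heq] at h

theorem nhds_coneTopology (hP : IsCone P) (hd : IsConeMetric P d) {e : E}
    (he : e ∈ interior P) (x : M) :
    @nhds M (coneTopology P d) x =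
      ⨅ n : ℕ, 𝓟 {y | ConeLt P (d y x) ((1 / ((n : ℝ) + 1)) • e)} := by
  apply le_antisymm
  · refine le_iInf fun n => le_principal_iff.2 (coneBall_mem_nhds hd x ?_)
    simpa [ConeLt] using hP.smul_mem_interior (t := 1 / ((n : ℝ) + 1)) (by positivity) he
  · rw [coneTopology, TopologicalSpace.nhds_generateFrom]
    refine le_iInf₂ ?_
    rintro _ ⟨hx, b, c, -, rfl⟩
    obtain ⟨n, hn⟩ := exists_nat_smul_coneLt hx e
    exact iInf_le_of_le n (principal_mono.2 (coneBall_subset hP hd hn))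

theorem firstCountableTopology_coneTopology (hP : IsCone P) (hint : (interior P).Nonempty)
    (hd : IsConeMetric P d) : @FirstCountableTopology M (coneTopology P d) := by
  obtain ⟨e, he⟩ := hint
  let _ : TopologicalSpace M := coneTopology P d
  refine ⟨fun x => ?_⟩
  rw [nhds_coneTopology hP hd he x]
  infer_instance

theorem coneConv_iff_tendsto (hP : IsCone P) (hint : (interior P).Nonempty)
    (hd : IsConeMetric P d) (u : ℕ → M) (x : M) :
    ConeConv P d u x ↔ Tendsto u atTop (@nhds M (coneTopology P d) x) := by
  obtain ⟨e, he⟩ := hint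
  constructor
  · intro h
    rw [nhds_coneTopology hP hd he x]
    refine tendsto_iInf.2 fun n => tendsto_principal.2 (eventually_atTop.2 (h _ ?_))
    simpa [ConeLt] using hP.smul_mem_interior (t := 1 / ((n : ℝ) + 1)) (by positivity) he
  · intro h c hc
    exact eventually_atTop.1 (h (coneBall_mem_nhds hd x hc))

end ConeMetric

/-- A self-map of a cone metric space is continuous with respect to the cone topology
iff it is sequentially continuous. -/
theorem coneContinuous_iff_seqContinuous {E M : Type*} [NormedAddCommGroup E]
    [NormedSpace ℝ E] [CompleteSpace E] [Nonempty M]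
    (P : Set E) (d : M → M → E)
    (hP : IsCone P) (hint : (interior P).Nonempty)
    (hd : IsConeMetric P d) (T : M → M) :
    @Continuous M M (coneTopology P d) (coneTopology P d) T ↔
      ConeSeqContinuous P d T := by
  let _ : TopologicalSpace M := coneTopology P d
  have _ : FirstCountableTopology M := firstCountableTopology_coneTopology hP hint hd
  rw [continuous_iff_seqContinuous]
  simp only [ConeSeqContinuous, coneConv_iff_tendsto hP hint hd]
  exact ⟨fun h u x hu => h hu, fun h u x hu => h u x hu⟩
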